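/- Suppose F is differentiable at a point x ∈ ℝⁿ, and let γ : (−∞,0] → ℝⁿ be a C¹ curve with γ(0) = x achieving the infimum defining F(x). Then γ'(0) = ∇F(x); in particular, (1/2)‖∇F(x)‖² = V(x). -/

import Mathlib

open MeasureTheory Set Filter

/-- The mechanical Lagrangian `L(x,v) = (1/2)‖v‖² + V(x)`. -/
noncomputable def lag {n : ℕ} (V : EuclideanSpace ℝ (Fin n) → ℝ)
    (x v : EuclideanSpace ℝ (Fin n)) : ℝ :=
  (1/2 : ℝ) * ‖v‖ ^ 2 + V x

/-- `γ` is absolutely continuous on `[a,b]`, with integrable a.e. derivative `g` there. -/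
def IsACOn {n : ℕ} (γ g : ℝ → EuclideanSpace ℝ (Fin n)) (a b : ℝ) : Prop :=
  IntegrableOn g (Set.Icc a b) ∧ ∀ t ∈ Set.Icc a b, γ t = γ a + ∫ u in a..t, g u

/-- The Lax–Oleinik semigroup
`S_T f(x) = inf { f(γ 0) + ∫₀ᵀ L(γ t, γ' t) dt : γ absolutely continuous, γ T = x }`. -/
noncomputable def laxOleinik {n : ℕ} (V : EuclideanSpace ℝ (Fin n) → ℝ) (T : ℝ)
    (f : EuclideanSpace ℝ (Fin n) → ℝ) (x : EuclideanSpace ℝ (Fin n)) : ℝ :=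
  sInf { r : ℝ | ∃ γ g : ℝ → EuclideanSpace ℝ (Fin n), IsACOn γ g 0 T ∧ γ T = x ∧
    r = f (γ 0) + ∫ t in (0:ℝ)..T, lag V (γ t) (g t) }

/-- `γ` is locally absolutely continuous on `(-∞,0]`, with a.e. derivative `g`. -/
def IsACIic {n : ℕ} (γ g : ℝ → EuclideanSpace ℝ (Fin n)) : Prop :=
  (∀ a : ℝ, a ≤ 0 → IntegrableOn g (Set.Icc a 0)) ∧
  ∀ t : ℝ, t ≤ 0 → γ 0 = γ t + ∫ u in t..(0:ℝ), g u

/-- The weak KAM solution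
`F(x) = inf { ∫_{-∞}^0 L(γ t, γ' t) dt : γ locally absolutely continuous on (-∞,0], γ 0 = x }`. -/
noncomputable def weakKAM {n : ℕ} (V : EuclideanSpace ℝ (Fin n) → ℝ)
    (x : EuclideanSpace ℝ (Fin n)) : ℝ :=
  sInf { r : ℝ | ∃ γ g : ℝ → EuclideanSpace ℝ (Fin n), IsACIic γ g ∧ γ 0 = x ∧
    IntegrableOn (fun t => lag V (γ t) (g t)) (Set.Iic 0) ∧
    r = ∫ t in Set.Iic (0:ℝ), lag V (γ t) (g t) }

/-- The Lagrangian is nonnegative when the potential is. -/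
theorem lag_nonneg {n : ℕ} {V : EuclideanSpace ℝ (Fin n) → ℝ} (hV : ∀ x, 0 ≤ V x)
    (x v : EuclideanSpace ℝ (Fin n)) : 0 ≤ lag V x v := by
  have := hV x
  unfold lag
  positivity

/-- The weak KAM solution at the endpoint of a curve defined on `(-∞, s]` is bounded above by the
action of the curve. -/
theorem weakKAM_le_integral_Iic {n : ℕ} {V : EuclideanSpace ℝ (Fin n) → ℝ} (hV : ∀ x, 0 ≤ V x)
    {δ g : ℝ → EuclideanSpace ℝ (Fin n)} {s : ℝ}
    (hg : ∀ a ≤ s, IntervalIntegrable g volume a s)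
    (hδ : ∀ a ≤ s, δ s = δ a + ∫ u in a..s, g u)
    (hint : IntegrableOn (fun t => lag V (δ t) (g t)) (Iic s)) :
    weakKAM V (δ s) ≤ ∫ t in Iic s, lag V (δ t) (g t) := by
  have hpre : (fun t : ℝ => t + s) ⁻¹' Iic s = Iic 0 := by
    ext t
    simp
  have hmp := measurePreserving_add_right (volume : Measure ℝ) s
  have hemb := measurableEmbedding_addRight s
  refine csInf_le ⟨0, ?_⟩ ⟨fun t => δ (t + s), fun t => g (t + s), ⟨?_, ?_⟩, by simp, ?_, ?_⟩
  · rintro r ⟨γ, g, -, -, -, rfl⟩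
    exact integral_nonneg fun t => lag_nonneg hV _ _
  · intro a ha
    rw [← intervalIntegrable_iff_integrableOn_Icc_of_le ha]
    simpa using (hg (a + s) (by linarith)).comp_add_right s
  · intro t ht
    rw [intervalIntegral.integral_comp_add_right (fun u => g u), zero_add]
    simpa using hδ (t + s) (by linarith)
  · have h := (hmp.integrableOn_comp_preimage hemb).2 hint
    rwa [hpre] at h
  · rw [← hmp.setIntegral_preimage_emb hemb, hpre]

/-- If `f` is bounded above by `h` on the right of `a`, with equality at `a`, then the derivatives
at `a` satisfy the same inequality. -/
theorem HasDerivAt.le_of_le_right {f h : ℝ → ℝ} {f' h' a : ℝ} (hf : HasDerivAt f f' a)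
    (hh : HasDerivAt h h' a) (ha : f a = h a) (hle : ∀ t, a < t → f t ≤ h t) : f' ≤ h' := by
  refine le_of_tendsto_of_tendsto (hasDerivWithinAt_iff_tendsto_slope' self_notMem_Ioi |>.1
    (hf.hasDerivWithinAt (s := Ioi a))) (hasDerivWithinAt_iff_tendsto_slope' self_notMem_Ioi |>.1
    (hh.hasDerivWithinAt (s := Ioi a))) ?_
  filter_upwards [self_mem_nhdsWithin] with t ht
  have ht' : 0 < t - a := sub_pos.2 ht
  simp only [slope_def_field, ha]
  gcongr
  exact hle t ht

/-- Along a `C¹` curve of finite action, the weak KAM solution at earlier times is bounded by the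
truncated action. -/
theorem weakKAM_le_of_nonpos {n : ℕ} {V : EuclideanSpace ℝ (Fin n) → ℝ} (hV : ∀ x, 0 ≤ V x)
    {γ : ℝ → EuclideanSpace ℝ (Fin n)} (hγ : ContDiff ℝ 1 γ)
    (hint : IntegrableOn (fun t => lag V (γ t) (deriv γ t)) (Iic 0)) {s : ℝ} (hs : s ≤ 0) :
    weakKAM V (γ s) ≤ (∫ t in Iic (0 : ℝ), lag V (γ t) (deriv γ t)) +
      ∫ t in (0 : ℝ)..s, lag V (γ t) (deriv γ t) := by
  have hints := hint.mono_set (Iic_subset_Iic.2 hs)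
  have hc : Continuous (deriv γ) := hγ.continuous_deriv_one
  rw [← intervalIntegral.integral_Iic_sub_Iic hint hints, add_sub_cancel]
  refine weakKAM_le_integral_Iic hV (fun a _ => hc.intervalIntegrable a s) (fun a _ => ?_) hints
  rw [intervalIntegral.integral_deriv_eq_sub
    (fun t _ => (hγ.differentiable one_ne_zero) t) (hc.intervalIntegrable a s), add_sub_cancel]

/-- Extending a `C¹` curve of finite action by a straight segment bounds the weak KAM solution at
the end of the segment. -/
theorem weakKAM_add_smul_le {n : ℕ} {V : EuclideanSpace ℝ (Fin n) → ℝ} (hV : ∀ x, 0 ≤ V x)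
    (hVc : Continuous V) {γ : ℝ → EuclideanSpace ℝ (Fin n)} (hγ : ContDiff ℝ 1 γ)
    (hint : IntegrableOn (fun t => lag V (γ t) (deriv γ t)) (Iic 0))
    (w : EuclideanSpace ℝ (Fin n)) {s : ℝ} (hs : 0 < s) :
    weakKAM V (γ 0 + s • w) ≤ (∫ t in Iic (0 : ℝ), lag V (γ t) (deriv γ t)) +
      ∫ t in (0 : ℝ)..s, lag V (γ 0 + t • w) w := by
  have hc : Continuous (deriv γ) := hγ.continuous_deriv_one
  set δ : ℝ → EuclideanSpace ℝ (Fin n) := fun t => if t ≤ 0 then γ t else γ 0 + t • w with hδ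
  set g : ℝ → EuclideanSpace ℝ (Fin n) := fun t => if t ≤ 0 then deriv γ t else w with hg
  have hδneg : ∀ t ≤ 0, δ t = γ t := fun t ht => if_pos ht
  have hgneg : ∀ t ≤ 0, g t = deriv γ t := fun t ht => if_pos ht
  have hδpos : ∀ t, 0 < t → δ t = γ 0 + t • w := fun t ht => if_neg ht.not_ge
  have hgpos : ∀ t, 0 < t → g t = w := fun t ht => if_neg ht.not_ge
  have hgnegOn : ∀ a ≤ 0, EqOn (deriv γ) g (uIoc a 0) := fun a ha t ht => by
    rw [uIoc_of_le ha] at ht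
    exact (hgneg t ht.2).symm
  have hgposOn : ∀ a b, 0 ≤ a → a ≤ b → EqOn (fun _ => w) g (uIoc a b) := fun a b ha hab t ht => by
    rw [uIoc_of_le hab] at ht
    exact (hgpos t (ha.trans_lt ht.1)).symm
  have hLneg : EqOn (fun t => lag V (γ t) (deriv γ t)) (fun t => lag V (δ t) (g t)) (Iic 0) :=
    fun t ht => by simp only [hδneg t ht, hgneg t ht]
  have hLpos : EqOn (fun t => lag V (γ 0 + t • w) w) (fun t => lag V (δ t) (g t)) (Ioc 0 s) :=
    fun t ht => by simp only [hδpos t ht.1, hgpos t ht.1]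
  have hline : Continuous fun t : ℝ => lag V (γ 0 + t • w) w := by
    unfold lag
    fun_prop
  have hIneg := hint.congr_fun hLneg measurableSet_Iic
  have hIpos : IntegrableOn (fun t => lag V (δ t) (g t)) (Ioc 0 s) :=
    (hline.integrableOn_Ioc).congr_fun hLpos measurableSet_Ioc
  have hgI : ∀ a b, 0 ≤ a → a ≤ b → IntervalIntegrable g volume a b := fun a b ha hab =>
    (intervalIntegrable_const (c := w)).congr (hgposOn a b ha hab)
  have hgI' : ∀ a ≤ 0, IntervalIntegrable g volume a 0 := fun a ha =>
    (hc.intervalIntegrable a 0).congr (hgnegOn a ha)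
  have hgint : ∀ a b, 0 ≤ a → a ≤ b → ∫ u in a..b, g u = (b - a) • w := fun a b ha hab => by
    rw [← intervalIntegral.integral_congr_ae (.of_forall (hgposOn a b ha hab)),
      intervalIntegral.integral_const]
  have key : weakKAM V (δ s) ≤ ∫ t in Iic s, lag V (δ t) (g t) := by
    refine weakKAM_le_integral_Iic hV (fun a ha => ?_) (fun a ha => ?_) ?_
    · rcases le_total a 0 with h | h
      · exact (hgI' a h).trans (hgI 0 s le_rfl hs.le)
      · exact hgI a s h ha
    · rcases le_or_gt a 0 with h | h
      · rw [← intervalIntegral.integral_add_adjacent_intervals (hgI' a h) (hgI 0 s le_rfl hs.le),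
          hgint 0 s le_rfl hs.le, ← intervalIntegral.integral_congr_ae (.of_forall (hgnegOn a h)),
          intervalIntegral.integral_deriv_eq_sub
            (fun t _ => (hγ.differentiable one_ne_zero) t) (hc.intervalIntegrable a 0),
          hδneg a h, hδpos s hs, sub_zero]
        abel
      · rw [hgint a s h.le ha, hδpos a h, hδpos s hs, sub_smul]
        abel
    · rw [← Iic_union_Ioc_eq_Iic hs.le]
      exact hIneg.union hIpos
  rwa [hδpos s hs, ← Iic_union_Ioc_eq_Iic hs.le,
    setIntegral_union (Iic_disjoint_Ioc le_rfl) measurableSet_Ioc hIneg hIpos,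
    ← setIntegral_congr_fun measurableSet_Iic hLneg,
    ← setIntegral_congr_fun measurableSet_Ioc hLpos,
    ← intervalIntegral.integral_of_le hs.le] at key

/-- If `F` is differentiable at `x` and `γ` is a `C¹` minimizer realizing `F(x)`, then
`γ'(0) = ∇F(x)`; in particular `(1/2)‖∇F(x)‖² = V(x)`. -/
theorem weakKAM_deriv_of_minimizer {n : ℕ} (V : EuclideanSpace ℝ (Fin n) → ℝ)
    (hV : ContDiff ℝ (⊤ : ℕ∞) V) (hVpos : ∀ x, 0 < V x)
    (hσ : ∃ σ g : ℝ → EuclideanSpace ℝ (Fin n), IsACIic σ g ∧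
      IntegrableOn (fun t => lag V (σ t) (g t)) (Set.Iic 0))
    (x : EuclideanSpace ℝ (Fin n))
    (hF : DifferentiableAt ℝ (weakKAM V) x)
    (γ : ℝ → EuclideanSpace ℝ (Fin n)) (hγ : ContDiff ℝ 1 γ) (hγ0 : γ 0 = x)
    (hint : IntegrableOn (fun t => lag V (γ t) (deriv γ t)) (Set.Iic 0))
    (hmin : ∫ t in Set.Iic (0:ℝ), lag V (γ t) (deriv γ t) = weakKAM V x) :
    deriv γ 0 = gradient (weakKAM V) x ∧
      (1/2 : ℝ) * ‖gradient (weakKAM V) x‖ ^ 2 = V x := by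
  have hV0 : ∀ y, 0 ≤ V y := fun y => (hVpos y).le
  have hVc : Continuous V := hV.continuous
  have hc : Continuous (deriv γ) := hγ.continuous_deriv_one
  subst hγ0
  set p := gradient (weakKAM V) (γ 0) with hp
  have hcomp : ∀ (δ : ℝ → EuclideanSpace ℝ (Fin n)) (v : EuclideanSpace ℝ (Fin n)) (a : ℝ),
      δ a = γ 0 → HasDerivAt δ v a →
      HasDerivAt (fun s => weakKAM V (δ s)) (inner ℝ p v) a := fun δ v a hδ h => by
    have hF' := hF.hasGradientAt.hasFDerivAt
    rw [← hδ] at hF'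
    simpa [hp, hδ, Function.comp_def] using hF'.comp_hasDerivAt a h
  have hforward : ∀ w, inner ℝ p w ≤ lag V (γ 0) w := fun w => by
    have hline : Continuous fun t : ℝ => lag V (γ 0 + t • w) w := by
      unfold lag
      fun_prop
    have hd : HasDerivAt (fun s : ℝ => γ 0 + s • w) w 0 := by
      simpa using ((hasDerivAt_id (0 : ℝ)).smul_const w).const_add (γ 0)
    have hA := (hline.integral_hasStrictDerivAt 0 0).hasDerivAt.const_add (weakKAM V (γ 0))
    have h := (hcomp _ w 0 (by simp) hd).le_of_le_right hA (by simp) fun s hs => by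
      have := weakKAM_add_smul_le hV0 hVc hγ hint w hs
      rwa [hmin] at this
    simpa using h
  have hbackward : lag V (γ 0) (deriv γ 0) ≤ inner ℝ p (deriv γ 0) := by
    have hL : Continuous fun t : ℝ => lag V (γ t) (deriv γ t) := by
      have := hγ.continuous
      unfold lag
      fun_prop
    have hd : HasDerivAt (fun s : ℝ => γ (-s)) (-deriv γ 0) 0 := by
      have h0 : HasDerivAt γ (deriv γ 0) (-0) := by
        simpa using ((hγ.differentiable one_ne_zero) 0).hasDerivAt
      simpa [Function.comp_def] using h0.scomp 0 (hasDerivAt_neg (0 : ℝ))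
    have hA : HasDerivAt (fun s : ℝ => weakKAM V (γ 0) +
        ∫ t in (0 : ℝ)..(-s), lag V (γ t) (deriv γ t)) (-lag V (γ 0) (deriv γ 0)) 0 := by
      have h0 := (hL.integral_hasStrictDerivAt 0 (-0)).hasDerivAt
      simpa using (h0.scomp 0 (hasDerivAt_neg (0 : ℝ))).const_add (weakKAM V (γ 0))
    have h := (hcomp _ _ 0 (by simp) hd).le_of_le_right hA (by simp) fun s hs => by
      have := weakKAM_le_of_nonpos hV0 hγ hint (s := -s) (by linarith)
      rwa [hmin] at this
    rw [inner_neg_right] at h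
    linarith
  have hself := hforward p
  rw [real_inner_self_eq_norm_sq] at hself
  have hsq := norm_sub_sq_real p (deriv γ 0)
  unfold lag at hself hbackward
  have hzero : ‖p - deriv γ 0‖ ^ 2 = 0 := le_antisymm (by linarith) (sq_nonneg _)
  have heq : p = deriv γ 0 := sub_eq_zero.1 (norm_eq_zero.1 (pow_eq_zero_iff two_ne_zero |>.1 hzero))
  refine ⟨heq.symm, ?_⟩
  rw [← heq, real_inner_self_eq_norm_sq] at hbackward
  linarith
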